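/- arXiv:2501.17089 — 7 statements merged into one kernel-verified Lean document; each statement's English description precedes it below -/
import Mathlib

section
/- Under the filter cascade setup, the included and excluded sets at every level are disjoint: for every n : ℕ, I n ∩ E n = ∅. -/
/-- In the filter cascade setup, the included and excluded working sets at
every level are disjoint. -/
theorem cascade_levels_disjoint {U : Type*} (V R : Finset U)
    (hVR : (V : Set U) ∩ (R : Set U) = ∅)
    (L : ℕ → Set U) (I E : ℕ → Set U)
    (hI0 : I 0 = (V : Set U)) (hE0 : E 0 = (R : Set U))
    (hI : ∀ n, I (n + 1) = E n ∩ L n) (hE : ∀ n, E (n + 1) = I n) :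
    ∀ n, I n ∩ E n = ∅ := by
  intro n
  induction n with
  | zero => rw [hI0, hE0]; exact hVR
  | succ k ih =>
    rw [hI, hE, Set.eq_empty_iff_forall_notMem]
    rintro x ⟨⟨hxE, _⟩, hxI⟩
    exact Set.eq_empty_iff_forall_notMem.mp ih x ⟨hxI, hxE⟩
end

section
/- Under the filter cascade setup, every credential ID that passes the first i levels still lies in the cascade's working sets at level i: for every i : ℕ and every id ∈ ↑V ∪ ↑R such that id ∈ L j for all j < i, we have id ∈ I i ∪ E i. -/
/-- In the filter cascade setup, every credential ID that passes the first
`i` levels still lies in the cascade's working sets at level `i`. -/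
theorem cascade_mem_working_sets {U : Type*} (V R : Finset U)
    (hVR : (V : Set U) ∩ (R : Set U) = ∅)
    (L : ℕ → Set U) (I E : ℕ → Set U)
    (hI0 : I 0 = (V : Set U)) (hE0 : E 0 = (R : Set U))
    (hI : ∀ n, I (n + 1) = E n ∩ L n) (hE : ∀ n, E (n + 1) = I n) :
    ∀ i : ℕ, ∀ id ∈ (V : Set U) ∪ (R : Set U),
      (∀ j < i, id ∈ L j) → id ∈ I i ∪ E i := by
  intro i id hid
  induction i with
  | zero =>
    intro _
    rw [hI0, hE0]
    exact hid
  | succ n ih =>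
    intro h
    rw [hI, hE]
    rcases ih (fun j hj => h j (Nat.lt_succ_of_lt hj)) with h1 | h1
    · exact Or.inr h1
    · exact Or.inl ⟨h1, h n (Nat.lt_succ_self n)⟩
end

section
/- Under the filter cascade setup, the parity pattern of membership holds: for every i : ℕ and every id ∈ ↑V ∪ ↑R such that id ∈ L j for all j < i, we have id ∈ I i ↔ (id ∈ ↑V ↔ Even i), and id ∈ E i ↔ (id ∈ ↑V ↔ Odd i). -/
/-- In the filter cascade setup, the parity pattern of membership holds:
an ID that passes the first `i` levels is in `I i` iff (it is valid iff `i` is even),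
and is in `E i` iff (it is valid iff `i` is odd). Even levels confirm cascade
membership and odd levels refute it. -/
theorem cascade_parity_pattern {U : Type*} (V R : Finset U)
    (hVR : (V : Set U) ∩ (R : Set U) = ∅)
    (L : ℕ → Set U) (I E : ℕ → Set U)
    (hI0 : I 0 = (V : Set U)) (hE0 : E 0 = (R : Set U))
    (hI : ∀ n, I (n + 1) = E n ∩ L n) (hE : ∀ n, E (n + 1) = I n) :
    ∀ i : ℕ, ∀ id ∈ (V : Set U) ∪ (R : Set U),
      (∀ j < i, id ∈ L j) →
        (id ∈ I i ↔ (id ∈ (V : Set U) ↔ Even i)) ∧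
        (id ∈ E i ↔ (id ∈ (V : Set U) ↔ Odd i)) := by
  intro i id hid
  induction i with
  | zero =>
    intro _
    have hdis : ¬ (id ∈ (V : Set U) ∧ id ∈ (R : Set U)) := by
      intro h
      have h2 : id ∈ (V : Set U) ∩ (R : Set U) := h
      rw [hVR] at h2
      exact h2
    have hid' : id ∈ (V : Set U) ∨ id ∈ (R : Set U) := hid
    have h0 : Even 0 := Even.zero
    have h1 : ¬ Odd 0 := Nat.not_odd_zero
    rw [hI0, hE0]
    tauto
  | succ n ih =>
    intro hL
    obtain ⟨h1, h2⟩ := ih (fun j hj => hL j (Nat.lt_succ_of_lt hj))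
    have hn : id ∈ L n := hL n (Nat.lt_succ_self n)
    have he : Even (n + 1) ↔ Odd n := by
      rw [Nat.even_add_one, Nat.not_even_iff_odd]
    have ho : Odd (n + 1) ↔ Even n := by
      rw [Nat.odd_add_one, Nat.not_odd_iff_even]
    rw [hI, hE, he, ho, Set.mem_inter_iff]
    exact ⟨⟨fun h => h2.1 h.1, fun h => ⟨h2.2 h, hn⟩⟩, h1⟩
end

section
/- Under the filter cascade setup with a cascade of length k (no false negatives and termination), any ID from V ∪ R that passes all k levels must lie in the final excluded set: for every id ∈ ↑V ∪ ↑R with id ∈ L j for all j < k, we have id ∈ E k, and consequently id ∈ ↑V ↔ Odd k. -/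
/-- In the filter cascade setup with a cascade of length `k` (no false
negatives and termination), any ID from `V ∪ R` that passes all `k` levels must lie in
the final excluded set `E k`, and consequently is valid iff `k` is odd. -/
theorem cascade_pass_all_levels {U : Type*} (V R : Finset U)
    (hVR : (V : Set U) ∩ (R : Set U) = ∅)
    (L : ℕ → Set U) (I E : ℕ → Set U)
    (hI0 : I 0 = (V : Set U)) (hE0 : E 0 = (R : Set U))
    (hI : ∀ n, I (n + 1) = E n ∩ L n) (hE : ∀ n, E (n + 1) = I n)
    (k : ℕ) (hnf : ∀ n < k, I n ⊆ L n) (hterm : I k = ∅) :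
    ∀ id ∈ (V : Set U) ∪ (R : Set U),
      (∀ j < k, id ∈ L j) → id ∈ E k ∧ (id ∈ (V : Set U) ↔ Odd k) := by
  intro x hx hL
  have hd : ¬ (x ∈ (V : Set U) ∧ x ∈ (R : Set U)) := by
    intro h
    have h2 : x ∈ (V : Set U) ∩ (R : Set U) := h
    rw [hVR] at h2
    exact h2
  have hu : x ∈ (V : Set U) ∨ x ∈ (R : Set U) := hx
  have key : ∀ n, n ≤ k → (x ∈ I n ↔ (x ∈ (V : Set U) ↔ Even n)) ∧
      (x ∈ E n ↔ (x ∈ (V : Set U) ↔ ¬ Even n)) := by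
    intro n
    induction n with
    | zero =>
      intro _
      rw [hI0, hE0]
      have h0 : Even 0 := Even.zero
      clear hx hterm hVR
      grind
    | succ n ih =>
      intro hn
      have h1 := ih (by omega)
      have h2 := hL n (by omega)
      rw [hI, hE, Set.mem_inter_iff, Nat.even_add_one]
      refine ⟨⟨fun h => h1.2.1 h.1, fun h => ⟨h1.2.2 h, h2⟩⟩, ?_⟩
      rw [not_not]
      exact h1.1
  have hk := key k le_rfl
  have hni : x ∉ I k := by
    rw [hterm]
    exact Set.notMem_empty x
  rw [← Nat.not_even_iff_odd]
  have hv : x ∈ (V : Set U) ↔ ¬ Even k := by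
    have h3 := fun h => hni (hk.1.2 h)
    clear hk key hu hd hx
    by_cases hev : Even k <;> by_cases hxv : x ∈ (V : Set U) <;> simp_all
  exact ⟨hk.2.2 hv, hv⟩
end

section
/- Completeness of the CRSet membership test (Algorithm 2): under the filter cascade setup with a cascade of length k, for every id ∈ ↑V (a valid, unrevoked credential ID), the membership test returns true; that is, either the least index i < k with id ∉ L i exists and is odd, or id ∈ L i for all i < k and k is odd. -/
/-- Completeness of the CRSet membership test: in the filter cascade
setup with a cascade of length `k`, every valid (unrevoked) ID makes the membership
test return true: either the least index `i < k` with `id ∉ L i` exists and is odd, or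
`id ∈ L i` for all `i < k` and `k` is odd. -/
theorem crset_membership_complete {U : Type*} (V R : Finset U)
    (hVR : (V : Set U) ∩ (R : Set U) = ∅)
    (L : ℕ → Set U) (I E : ℕ → Set U)
    (hI0 : I 0 = (V : Set U)) (hE0 : E 0 = (R : Set U))
    (hI : ∀ n, I (n + 1) = E n ∩ L n) (hE : ∀ n, E (n + 1) = I n)
    (k : ℕ) (hnf : ∀ n < k, I n ⊆ L n) (hterm : I k = ∅) :
    ∀ id ∈ (V : Set U),
      (∃ i, i < k ∧ id ∉ L i ∧ (∀ j < i, id ∈ L j) ∧ Odd i) ∨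
      ((∀ i < k, id ∈ L i) ∧ Odd k) := by
  intro x hx
  have key : ∀ n, (∀ j < n, x ∈ L j) → (Even n → x ∈ I n) ∧ (Odd n → x ∈ E n) := by
    intro n
    induction n with
    | zero =>
      intro _
      refine ⟨fun _ => by rw [hI0]; exact hx, fun h => ?_⟩
      exact absurd h (by decide)
    | succ n ih =>
      intro h
      obtain ⟨h1, h2⟩ := ih (fun j hj => h j (Nat.lt_succ_of_lt hj))
      constructor
      · intro he
        have ho : Odd n := by
          rw [Nat.even_add_one, Nat.not_even_iff_odd] at he
          exact he
        rw [hI]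
        exact ⟨h2 ho, h n (Nat.lt_succ_self n)⟩
      · intro ho
        have he : Even n := by
          rw [Nat.odd_add_one, Nat.not_odd_iff_even] at ho
          exact ho
        rw [hE]
        exact h1 he
  by_cases hall : ∀ i < k, x ∈ L i
  · right
    refine ⟨hall, ?_⟩
    by_contra hk
    have hmem := (key k hall).1 (Nat.not_odd_iff_even.mp hk)
    rw [hterm] at hmem
    exact hmem
  · left
    classical
    have hex : ∃ i, i < k ∧ x ∉ L i := by
      by_contra hne
      exact hall fun i hi => by_contra fun hx' => hne ⟨i, hi, hx'⟩
    obtain ⟨hlt, hnot⟩ := Nat.find_spec hex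
    have hmin : ∀ j < Nat.find hex, x ∈ L j := fun j hj =>
      by_contra fun hx' => Nat.find_min hex hj ⟨hj.trans hlt, hx'⟩
    refine ⟨Nat.find hex, hlt, hnot, hmin, ?_⟩
    by_contra hodd
    exact hnot (hnf _ hlt ((key _ hmin).1 (Nat.not_odd_iff_even.mp hodd)))
end

section
/- Soundness of the CRSet membership test (Algorithm 2): under the filter cascade setup with a cascade of length k, for every id ∈ ↑R (a revoked credential ID), the membership test returns false; that is, either the least index i < k with id ∉ L i exists and is even, or id ∈ L i for all i < k and k is even. -/
/-- Soundness of the CRSet membership test: in the filter cascade setup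
with a cascade of length `k`, every revoked ID makes the membership test return false:
either the least index `i < k` with `id ∉ L i` exists and is even, or `id ∈ L i` for
all `i < k` and `k` is even. -/
theorem crset_membership_sound {U : Type*} (V R : Finset U)
    (hVR : (V : Set U) ∩ (R : Set U) = ∅)
    (L : ℕ → Set U) (I E : ℕ → Set U)
    (hI0 : I 0 = (V : Set U)) (hE0 : E 0 = (R : Set U))
    (hI : ∀ n, I (n + 1) = E n ∩ L n) (hE : ∀ n, E (n + 1) = I n)
    (k : ℕ) (hnf : ∀ n < k, I n ⊆ L n) (hterm : I k = ∅) :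
    ∀ id ∈ (R : Set U),
      (∃ i, i < k ∧ id ∉ L i ∧ (∀ j < i, id ∈ L j) ∧ Even i) ∨
      ((∀ i < k, id ∈ L i) ∧ Even k) := by
  intro id hid
  have key : ∀ n, (∀ j < n, id ∈ L j) → (Even n → id ∈ E n) ∧ (¬ Even n → id ∈ I n) := by
    intro n
    induction n with
    | zero => intro _; simpa [hE0] using hid
    | succ n ih =>
      intro h
      obtain ⟨h1, h2⟩ := ih (fun j hj => h j (by omega))
      rw [Nat.even_add_one, not_not, hE, hI]
      exact ⟨h2, fun he => ⟨h1 he, h n (by omega)⟩⟩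
  classical
  by_cases hall : ∀ i < k, id ∈ L i
  · right
    refine ⟨hall, ?_⟩
    by_contra hk
    have := (key k hall).2 hk
    rw [hterm] at this
    exact this
  · left
    have hex : ∃ i, i < k ∧ id ∉ L i := by
      push Not at hall
      exact hall
    obtain ⟨hlt, hn⟩ := Nat.find_spec hex
    have hmin : ∀ j < Nat.find hex, id ∈ L j := by
      intro j hj
      by_contra hc
      exact Nat.find_min hex hj ⟨by omega, hc⟩
    refine ⟨Nat.find hex, hlt, hn, hmin, ?_⟩
    by_contra hodd
    exact hn (hnf _ hlt ((key _ hmin).2 hodd))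
end

section
/- Correctness of the CRSet membership test (Algorithm 2): under the filter cascade setup with a cascade of length k, for every id ∈ ↑V ∪ ↑R, the membership test returns true if and only if id ∈ ↑V. In other words, on inputs that are IDs of actually issued credentials, the test never produces a false positive or a false negative, so the index of the first filter that does not contain a given ID exactly determines its revocation status. -/
/-- Correctness of the CRSet membership test: in the filter cascade
setup with a cascade of length `k`, for every ID of an actually issued credential
(`id ∈ V ∪ R`), the membership test returns true (the least index `i < k` with
`id ∉ L i` exists and is odd, or no such index exists and `k` is odd) if and only if
the credential is valid, i.e. `id ∈ V`. -/
theorem crset_membership_correct {U : Type*} (V R : Finset U)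
    (hVR : (V : Set U) ∩ (R : Set U) = ∅)
    (L : ℕ → Set U) (I E : ℕ → Set U)
    (hI0 : I 0 = (V : Set U)) (hE0 : E 0 = (R : Set U))
    (hI : ∀ n, I (n + 1) = E n ∩ L n) (hE : ∀ n, E (n + 1) = I n)
    (k : ℕ) (hnf : ∀ n < k, I n ⊆ L n) (hterm : I k = ∅) :
    ∀ id ∈ (V : Set U) ∪ (R : Set U),
      (((∃ i, i < k ∧ id ∉ L i ∧ (∀ j < i, id ∈ L j) ∧ Odd i) ∨
        ((∀ i < k, id ∈ L i) ∧ Odd k)) ↔ id ∈ (V : Set U)) := by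
  intro id hid
  have key : ∀ n, (∀ j < n, id ∈ L j) →
      ((id ∈ (V : Set U) → (Even n → id ∈ I n) ∧ (Odd n → id ∈ E n)) ∧
       (id ∈ (R : Set U) → (Odd n → id ∈ I n) ∧ (Even n → id ∈ E n))) := by
    intro n
    induction n with
    | zero =>
      intro _
      rw [hI0, hE0]
      simp
    | succ n ih =>
      intro h
      have h1 := ih (fun j hj => h j (by omega))
      have h2 := h n (by omega)
      rw [hI, hE, Nat.even_add_one, Nat.odd_add_one, Nat.not_even_iff_odd, Nat.not_odd_iff_even]
      exact ⟨fun hv => ⟨fun ho => ⟨(h1.1 hv).2 ho, h2⟩, (h1.1 hv).1⟩,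
        fun hr => ⟨fun he => ⟨(h1.2 hr).2 he, h2⟩, (h1.2 hr).1⟩⟩
  constructor
  · intro h
    rcases hid with hv | hr
    · exact hv
    · exfalso
      rcases h with ⟨i, hik, hi, hj, ho⟩ | ⟨hall, ho⟩
      · exact hi (hnf i hik (((key i hj).2 hr).1 ho))
      · have := ((key k hall).2 hr).1 ho
        rw [hterm] at this
        exact this
  · intro hv
    by_cases hall : ∀ i < k, id ∈ L i
    · right
      refine ⟨hall, ?_⟩
      by_contra ho
      have := ((key k hall).1 hv).1 (Nat.not_odd_iff_even.mp ho)
      rw [hterm] at this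
      exact this
    · left
      classical
      have hex : ∃ i, i < k ∧ id ∉ L i := by
        push Not at hall
        exact hall
      obtain ⟨hik, hi⟩ := Nat.find_spec hex
      have hj : ∀ j < Nat.find hex, id ∈ L j := by
        intro j hj
        by_contra hn
        exact Nat.find_min hex hj ⟨hj.trans hik, hn⟩
      refine ⟨Nat.find hex, hik, hi, hj, ?_⟩
      by_contra ho
      exact hi (hnf _ hik (((key _ hj).1 hv).1 (Nat.not_odd_iff_even.mp ho)))
end
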